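/- arXiv:2510.20383 — 4 statements merged into one kernel-verified Lean document; each statement's English description precedes it below -/
import Mathlib

section
/- Let n, m, T be positive natural numbers, let S be a real n×m matrix, and for t = 1,…,T let y⁽ᵗ⁾ ∈ ℝⁿ (observations) and ŷ⁽ᵗ⁾ ∈ ℝⁿ (base forecasts). Let W̲ and W̄ be symmetric real n×n matrices, and assume there exists a symmetric positive definite real n×n matrix W′ with W̲ᵢⱼ < W′ᵢⱼ < W̄ᵢⱼ for all indices i, j. For a real m×n matrix P, let E(P) denote the n×T matrix whose t-th column is y⁽ᵗ⁾ − S·P·ŷ⁽ᵗ⁾. Then the optimal value of the robust min–max problem equals the optimal value of the semidefinite program; that is, infimum over P ∈ ℝ^{m×n} of the supremum of ∑_{t=1}^{T} (y⁽ᵗ⁾ − S·P·ŷ⁽ᵗ⁾)ᵀ W (y⁽ᵗ⁾ − S·P·ŷ⁽ᵗ⁾) over all symmetric W ∈ ℝ^{n×n} with W̲ ≤ W ≤ W̄ entrywise and W positive semidefinite, equals the infimum of tr(W̄ᵀ X̄) − tr(W̲ᵀ X̲) over all symmetric X̄, X̲ ∈ ℝ^{n×n} with all entries nonnegative and all P ∈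 ℝ^{m×n} such that the (n+T)×(n+T) block matrix [[X̄ − X̲, E(P)], [E(P)ᵀ, I_T]] is positive semidefinite. -/
open Matrix

namespace RobustReconciliation

/-- A sublinear function on a real vector space has a supporting linear functional at each point. -/
theorem exists_linearMap_eq_of_sublinear {E : Type*} [AddCommGroup E] [Module ℝ E] (N : E → ℝ)
    (N_hom : ∀ c : ℝ, 0 < c → ∀ x, N (c • x) = c * N x)
    (N_add : ∀ x y, N (x + y) ≤ N x + N y) (x₀ : E) :
    ∃ g : E →ₗ[ℝ] ℝ, g x₀ = N x₀ ∧ ∀ x, g x ≤ N x := by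
  have N_zero : N 0 = 0 := by
    have := N_hom 2 (by norm_num) 0
    rw [smul_zero] at this
    linarith
  rcases eq_or_ne x₀ 0 with rfl | hx₀
  · obtain ⟨g, -, hg⟩ := exists_extension_of_le_sublinear (⊥ : E →ₗ.[ℝ] ℝ) N N_hom N_add (by
      rintro ⟨x, hx⟩
      obtain rfl : x = 0 := (Submodule.mem_bot ℝ).1 hx
      exact (LinearPMap.map_zero _).le.trans N_zero.ge)
    exact ⟨g, by rw [map_zero, N_zero], hg⟩
  · obtain ⟨g, hg, hgN⟩ := exists_extension_of_le_sublinear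
      (LinearPMap.mkSpanSingleton x₀ (N x₀) hx₀) N N_hom N_add (by
      rintro ⟨x, hx⟩
      obtain ⟨c, rfl⟩ := Submodule.mem_span_singleton.1 hx
      refine (LinearPMap.mkSpanSingleton'_apply x₀ (N x₀) _ c hx).trans_le ?_
      change c * N x₀ ≤ N (c • x₀)
      rcases lt_trichotomy c 0 with hc | rfl | hc
      · have h₁ := N_add (c • x₀) ((-c) • x₀)
        rw [← add_smul, add_neg_cancel, zero_smul, N_zero, N_hom (-c) (by linarith)] at h₁
        linarith
      · simp [N_zero]
      · exact (N_hom c hc x₀).ge)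
    refine ⟨g, ?_, hgN⟩
    have := hg ⟨x₀, Submodule.mem_span_singleton_self x₀⟩
    rw [this]
    exact LinearPMap.mkSpanSingleton_apply ℝ ℝ hx₀ _

theorem sInf_setOf_eq_sInf_iUnion {α : Type*} [Nonempty α] (s : α → Set ℝ)
    (hne : ∀ a, (s a).Nonempty) {b : ℝ} (hb : ∀ a, b ∈ lowerBounds (s a)) :
    sInf {v | ∃ a, v = sInf (s a)} = sInf (⋃ a, s a) := by
  have hb' : b ∈ lowerBounds {v | ∃ a, v = sInf (s a)} := by
    rintro _ ⟨a, rfl⟩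
    exact le_csInf (hne a) (hb a)
  have hb'' : b ∈ lowerBounds (⋃ a, s a) := fun v hv =>
    (Set.mem_iUnion.1 hv).elim fun a ha => hb a ha
  let a₀ : α := Classical.arbitrary α
  apply le_antisymm
  · refine le_csInf ((hne a₀).mono (Set.subset_iUnion s a₀)) fun v hv => ?_
    obtain ⟨a, ha⟩ := Set.mem_iUnion.1 hv
    exact (csInf_le ⟨b, hb'⟩ ⟨a, rfl⟩).trans (csInf_le ⟨b, hb a⟩ ha)
  · refine le_csInf ⟨_, a₀, rfl⟩ ?_
    rintro _ ⟨a, rfl⟩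
    exact csInf_le_csInf ⟨b, hb''⟩ (hne a) (Set.subset_iUnion s a)

variable {ι : Type*} [Fintype ι]

theorem trace_transpose_mul_eq_sum (A B : Matrix ι ι ℝ) :
    (Aᵀ * B).trace = ∑ i, ∑ j, A i j * B i j := by
  simp only [trace, diag_apply, mul_apply, transpose_apply]
  exact Finset.sum_comm

theorem dotProduct_transpose_mulVec_self (A : Matrix ι ι ℝ) (z : ι → ℝ) :
    z ⬝ᵥ (Aᵀ *ᵥ z) = z ⬝ᵥ (A *ᵥ z) := by
  rw [mulVec_transpose, dotProduct_comm, dotProduct_mulVec]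

open scoped MatrixOrder in
theorem trace_mul_nonneg_of_posSemidef {W D : Matrix ι ι ℝ} (hW : W.PosSemidef)
    (hD : ∀ z : ι → ℝ, 0 ≤ z ⬝ᵥ (D *ᵥ z)) : 0 ≤ (W * D).trace := by
  classical
  obtain ⟨B, rfl⟩ := CStarAlgebra.nonneg_iff_eq_star_mul_self.1 hW.nonneg
  rw [Matrix.mul_assoc, trace_mul_comm, trace]
  refine Finset.sum_nonneg fun k _ => ?_
  refine (hD (B k)).trans_eq ?_
  rw [diag_apply, Matrix.mul_assoc, mul_apply]
  simp [dotProduct, mulVec, mul_apply, star_eq_conjTranspose]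

/-- Values of the objective `tr (W * C)` over the positive semidefinite matrices in a box. -/
def boxPrimalValues (Wlo Whi C : Matrix ι ι ℝ) : Set ℝ :=
  {u | ∃ W : Matrix ι ι ℝ, W.IsSymm ∧ (∀ i j, Wlo i j ≤ W i j ∧ W i j ≤ Whi i j) ∧
    W.PosSemidef ∧ u = (W * C).trace}

/-- Values of the dual of the maximization of `tr (W * C)` over the positive semidefinite
matrices in a box. -/
def boxDualValues (Wlo Whi C : Matrix ι ι ℝ) : Set ℝ :=
  {v | ∃ Xhi Xlo : Matrix ι ι ℝ, Xhi.IsSymm ∧ Xlo.IsSymm ∧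
    (∀ i j, 0 ≤ Xhi i j) ∧ (∀ i j, 0 ≤ Xlo i j) ∧
    (∀ z : ι → ℝ, z ⬝ᵥ (C *ᵥ z) ≤ z ⬝ᵥ ((Xhi - Xlo) *ᵥ z)) ∧
    v = (Whiᵀ * Xhi).trace - (Wloᵀ * Xlo).trace}

variable {Wlo Whi C : Matrix ι ι ℝ}

theorem primal_le_dual {u v : ℝ} (hu : u ∈ boxPrimalValues Wlo Whi C)
    (hv : v ∈ boxDualValues Wlo Whi C) : u ≤ v := by
  obtain ⟨W, hWs, hbox, hW, rfl⟩ := hu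
  obtain ⟨Xhi, Xlo, -, -, hhi, hlo, hq, rfl⟩ := hv
  have h₀ : 0 ≤ (W * (Xhi - Xlo - C)).trace :=
    trace_mul_nonneg_of_posSemidef hW fun z => by
      rw [sub_mulVec _ C, dotProduct_sub]
      linarith [hq z]
  have h₁ : (W * Xhi).trace ≤ (Whiᵀ * Xhi).trace := by
    nth_rewrite 1 [← hWs.eq]
    rw [trace_transpose_mul_eq_sum, trace_transpose_mul_eq_sum]
    exact Finset.sum_le_sum fun i _ => Finset.sum_le_sum fun j _ =>
      mul_le_mul_of_nonneg_right (hbox i j).2 (hhi i j)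
  have h₂ : (Wloᵀ * Xlo).trace ≤ (W * Xlo).trace := by
    nth_rewrite 1 [← hWs.eq]
    rw [trace_transpose_mul_eq_sum, trace_transpose_mul_eq_sum]
    exact Finset.sum_le_sum fun i _ => Finset.sum_le_sum fun j _ =>
      mul_le_mul_of_nonneg_right (hbox i j).1 (hlo i j)
  rw [Matrix.mul_sub, Matrix.mul_sub, trace_sub, trace_sub] at h₀
  linarith

theorem boxDualValues_nonempty (Wlo Whi C : Matrix ι ι ℝ) :
    (boxDualValues Wlo Whi C).Nonempty := by
  let Y : Matrix ι ι ℝ := (1 / 2 : ℝ) • (C + Cᵀ)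
  have hY : ∀ i j, Y j i = Y i j := fun i j => by simp [Y, add_comm]
  refine ⟨_, of fun i j => max (Y i j) 0, of fun i j => max (-Y i j) 0, ?_, ?_, ?_, ?_, ?_, rfl⟩
  · ext i j; simp [hY i j]
  · ext i j; simp [hY i j]
  · intro i j; simp
  · intro i j; simp
  · intro z
    have : (of fun i j => max (Y i j) 0) - (of fun i j => max (-Y i j) 0) = Y := by
      ext i j
      rw [Matrix.sub_apply, of_apply, of_apply]
      rcases le_total 0 (Y i j) with h | h <;> simp [h]
    rw [this, smul_mulVec, add_mulVec, dotProduct_smul, dotProduct_add,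
      dotProduct_transpose_mulVec_self, smul_eq_mul]
    linarith

theorem add_mem_boxDualValues {C' : Matrix ι ι ℝ} {v v' : ℝ} (hv : v ∈ boxDualValues Wlo Whi C)
    (hv' : v' ∈ boxDualValues Wlo Whi C') : v + v' ∈ boxDualValues Wlo Whi (C + C') := by
  obtain ⟨Xhi, Xlo, hs, hs', hhi, hlo, hq, rfl⟩ := hv
  obtain ⟨Yhi, Ylo, ht, ht', khi, klo, kq, rfl⟩ := hv'
  refine ⟨Xhi + Yhi, Xlo + Ylo, hs.add ht, hs'.add ht', fun i j => add_nonneg (hhi i j) (khi i j),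
    fun i j => add_nonneg (hlo i j) (klo i j), fun z => ?_, ?_⟩
  · rw [add_sub_add_comm, add_mulVec, add_mulVec, dotProduct_add, dotProduct_add]
    exact add_le_add (hq z) (kq z)
  · rw [Matrix.mul_add, Matrix.mul_add, trace_add, trace_add]
    ring

theorem smul_mem_boxDualValues {c v : ℝ} (hc : 0 ≤ c) (hv : v ∈ boxDualValues Wlo Whi C) :
    c * v ∈ boxDualValues Wlo Whi (c • C) := by
  obtain ⟨Xhi, Xlo, hs, hs', hhi, hlo, hq, rfl⟩ := hv
  refine ⟨c • Xhi, c • Xlo, hs.smul c, hs'.smul c, fun i j => mul_nonneg hc (hhi i j),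
    fun i j => mul_nonneg hc (hlo i j), fun z => ?_, ?_⟩
  · rw [← smul_sub, smul_mulVec, smul_mulVec, dotProduct_smul, dotProduct_smul]
    exact mul_le_mul_of_nonneg_left (hq z) hc
  · rw [Matrix.mul_smul, Matrix.mul_smul, trace_smul, trace_smul, smul_eq_mul, smul_eq_mul]
    ring

theorem boxPrimalValues_nonempty (C : Matrix ι ι ℝ) {W : Matrix ι ι ℝ} (hW : W.PosSemidef)
    (hbox : ∀ i j, Wlo i j ≤ W i j ∧ W i j ≤ Whi i j) : (boxPrimalValues Wlo Whi C).Nonempty :=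
  ⟨_, W, isHermitian_iff_isSymm.1 hW.isHermitian, hbox, hW, rfl⟩

theorem bddBelow_boxDualValues (h : (boxPrimalValues Wlo Whi C).Nonempty) :
    BddBelow (boxDualValues Wlo Whi C) :=
  h.elim fun u hu => ⟨u, fun _ hv => primal_le_dual hu hv⟩

/-- A symmetrized matrix unit. -/
theorem exists_symm_nonneg_trace_eq [DecidableEq ι] (i j : ι) :
    ∃ X : Matrix ι ι ℝ, X.IsSymm ∧ (∀ k l, 0 ≤ X k l) ∧
      (∀ z : ι → ℝ, z ⬝ᵥ (X *ᵥ z) = z ⬝ᵥ (single i j 1 *ᵥ z)) ∧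
      ∀ A : Matrix ι ι ℝ, A.IsSymm → (Aᵀ * X).trace = A i j := by
  refine ⟨(1 / 2 : ℝ) • (single i j 1 + (single i j 1)ᵀ), ?_, ?_, ?_, ?_⟩
  · rw [IsSymm, transpose_smul, transpose_add, transpose_transpose, add_comm]
  · intro k l
    have h : ∀ a b : ι, (0 : ℝ) ≤ single i j (1 : ℝ) a b := fun a b => by
      rw [single_apply]; split_ifs <;> norm_num
    exact mul_nonneg (by norm_num) (add_nonneg (h k l) (h l k))
  · intro z
    rw [smul_mulVec, add_mulVec, dotProduct_smul, dotProduct_add,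
      dotProduct_transpose_mulVec_self, smul_eq_mul]
    ring
  · intro A hA
    have h : (A * single i j 1).trace = A j i := by
      simp [trace_mul_single]
    rw [Matrix.mul_smul, Matrix.mul_add, trace_smul, trace_add, ← transpose_mul, trace_transpose,
      trace_mul_comm _ A, hA.eq, h, hA.apply, smul_eq_mul]
    ring

/-- Strong duality with primal attainment. -/
theorem sInf_boxDualValues_mem_boxPrimalValues {W₀ : Matrix ι ι ℝ} (hW₀ : W₀.PosSemidef)
    (hbox : ∀ i j, Wlo i j ≤ W₀ i j ∧ W₀ i j ≤ Whi i j) (hWlo : Wlo.IsSymm) (hWhi : Whi.IsSymm)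
    (C : Matrix ι ι ℝ) :
    sInf (boxDualValues Wlo Whi C) ∈ boxPrimalValues Wlo Whi C := by
  classical
  set N : Matrix ι ι ℝ → ℝ := fun X => sInf (boxDualValues Wlo Whi X)
  have hbdd : ∀ X, BddBelow (boxDualValues Wlo Whi X) := fun X =>
    bddBelow_boxDualValues (boxPrimalValues_nonempty X hW₀ hbox)
  have hne := boxDualValues_nonempty Wlo Whi
  have N_smul_le : ∀ c : ℝ, 0 < c → ∀ X, N (c • X) ≤ c * N X := fun c hc X => by
    rw [← div_le_iff₀' hc]
    refine le_csInf (hne X) fun v hv => ?_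
    rw [div_le_iff₀' hc]
    exact csInf_le (hbdd _) (smul_mem_boxDualValues hc.le hv)
  obtain ⟨g, hgC, hgN⟩ := exists_linearMap_eq_of_sublinear N
    (fun c hc X => (N_smul_le c hc X).antisymm <| by
      have := N_smul_le c⁻¹ (inv_pos.2 hc) (c • X)
      rwa [smul_smul, inv_mul_cancel₀ hc.ne', one_smul, le_inv_mul_iff₀ hc] at this)
    (fun X Y => by
      rw [← sub_le_iff_le_add]
      refine le_csInf (hne X) fun v hv => ?_
      rw [sub_le_comm]
      refine le_csInf (hne Y) fun w hw => ?_
      rw [sub_le_iff_le_add']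
      exact csInf_le (hbdd _) (add_mem_boxDualValues hv hw)) C
  have g_nonpos : ∀ X : Matrix ι ι ℝ, (∀ z : ι → ℝ, z ⬝ᵥ (X *ᵥ z) ≤ 0) → g X ≤ 0 :=
    fun X hX => (hgN X).trans <| csInf_le (hbdd X)
      ⟨0, 0, isSymm_zero, isSymm_zero, fun _ _ => le_rfl, fun _ _ => le_rfl,
        fun z => by simpa using hX z, by simp⟩
  let W : Matrix ι ι ℝ := of fun i j => g (single j i 1)
  have hgW : ∀ X, g X = (W * X).trace := fun X => by
    conv_lhs => rw [matrix_eq_sum_single X]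
    simp only [map_sum, trace, diag_apply, mul_apply, W, of_apply]
    rw [Finset.sum_comm]
    refine Finset.sum_congr rfl fun i _ => Finset.sum_congr rfl fun j _ => ?_
    rw [← mul_one (X j i), ← smul_eq_mul, ← smul_single, map_smul, smul_eq_mul, smul_eq_mul,
      mul_one, mul_comm]
  have g_transpose_le : ∀ X : Matrix ι ι ℝ, g Xᵀ ≤ g X := fun X => by
    rw [← sub_nonpos, ← map_sub]
    refine g_nonpos _ fun z => ?_
    rw [sub_mulVec, dotProduct_sub, dotProduct_transpose_mulVec_self, sub_self]
  have hWs : W.IsSymm := by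
    ext i j
    have h₁ := g_transpose_le (single i j 1)
    have h₂ := g_transpose_le (single j i 1)
    rw [transpose_single] at h₁ h₂
    exact h₂.antisymm h₁
  refine ⟨W, hWs, fun i j => ?_, ?_, ?_⟩
  · obtain ⟨X, hXs, hX, hXq, hXt⟩ := exists_symm_nonneg_trace_eq i j
    have hW : g (single i j 1) = W i j := hWs.apply i j
    constructor
    · have : g (-single i j 1) ≤ -Wlo i j := (hgN _).trans <| csInf_le (hbdd _)
        ⟨0, X, isSymm_zero, hXs, fun _ _ => le_rfl, hX,
          fun z => by rw [zero_sub, neg_mulVec, neg_mulVec, dotProduct_neg, dotProduct_neg, hXq],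
          by rw [hXt _ hWlo, Matrix.mul_zero, trace_zero, zero_sub]⟩
      rw [map_neg, hW] at this
      linarith
    · rw [← hW]
      exact (hgN _).trans <| csInf_le (hbdd _)
        ⟨X, 0, hXs, isSymm_zero, hX, fun _ _ => le_rfl, fun z => by rw [sub_zero, hXq],
          by rw [hXt _ hWhi, Matrix.mul_zero, trace_zero, sub_zero]⟩
  · refine .of_dotProduct_mulVec_nonneg (isHermitian_iff_isSymm.2 hWs) fun x => ?_
    have h := g_nonpos (-vecMulVec x x) fun z => by
      rw [neg_mulVec, dotProduct_neg, vecMulVec_mulVec]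
      simp only [dotProduct_smul, op_smul_eq_smul, smul_eq_mul]
      rw [dotProduct_comm z x, neg_nonpos]
      exact mul_self_nonneg _
    rw [map_neg, hgW, mul_vecMulVec, trace_vecMulVec, neg_nonpos, dotProduct_comm] at h
    simpa using h
  · rw [← hgW, hgC]

theorem sSup_boxPrimalValues_eq_sInf_boxDualValues {W₀ : Matrix ι ι ℝ} (hW₀ : W₀.PosSemidef)
    (hbox : ∀ i j, Wlo i j ≤ W₀ i j ∧ W₀ i j ≤ Whi i j) (hWlo : Wlo.IsSymm) (hWhi : Whi.IsSymm)
    (C : Matrix ι ι ℝ) :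
    sSup (boxPrimalValues Wlo Whi C) = sInf (boxDualValues Wlo Whi C) :=
  IsGreatest.csSup_eq ⟨sInf_boxDualValues_mem_boxPrimalValues hW₀ hbox hWlo hWhi C,
    fun _ hu => le_csInf (boxDualValues_nonempty Wlo Whi C) fun _ hv => primal_le_dual hu hv⟩

theorem sum_dotProduct_mulVec_eq_trace {κ : Type*} [Fintype κ] (W : Matrix ι ι ℝ)
    (E : Matrix ι κ ℝ) :
    ∑ t, (fun i => E i t) ⬝ᵥ (W *ᵥ fun i => E i t) = (W * (E * Eᵀ)).trace := by
  rw [← Matrix.mul_assoc, trace_mul_comm, trace]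
  refine Finset.sum_congr rfl fun t _ => ?_
  simp [dotProduct, mulVec, mul_apply]

theorem posSemidef_fromBlocks_one_iff {κ : Type*} [Fintype κ] [DecidableEq κ]
    {X : Matrix ι ι ℝ} (hX : X.IsSymm) (E : Matrix ι κ ℝ) :
    (fromBlocks X E Eᵀ (1 : Matrix κ κ ℝ)).PosSemidef ↔
      ∀ z : ι → ℝ, z ⬝ᵥ ((E * Eᵀ) *ᵥ z) ≤ z ⬝ᵥ (X *ᵥ z) := by
  let _ : Invertible (1 : Matrix κ κ ℝ) := invertibleOne
  have h := PosDef.fromBlocks₂₂ (D := (1 : Matrix κ κ ℝ)) X E PosDef.one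
  rw [conjTranspose_eq_transpose_of_trivial, inv_one, Matrix.mul_one] at h
  rw [h, posSemidef_iff_dotProduct_mulVec]
  have hs : (X - E * Eᵀ).IsHermitian :=
    isHermitian_iff_isSymm.2 (hX.sub (by rw [IsSymm, transpose_mul, transpose_transpose]))
  simp only [hs, true_and, star_trivial, sub_mulVec, dotProduct_sub, sub_nonneg]

end RobustReconciliation

open RobustReconciliation in
/-- Equivalence of optimal values between the robust min–max reconciliation
problem and its semidefinite reformulation. -/
theorem robust_minmax_eq_sdp
    (n m T : ℕ) (hn : 0 < n) (hm : 0 < m) (hT : 0 < T)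
    (S : Matrix (Fin n) (Fin m) ℝ)
    (y yhat : Fin T → Fin n → ℝ)
    (Wlo Whi : Matrix (Fin n) (Fin n) ℝ)
    (hWlo : Wlo.IsSymm) (hWhi : Whi.IsSymm)
    (hstrict : ∃ W' : Matrix (Fin n) (Fin n) ℝ, W'.IsSymm ∧ W'.PosDef ∧
      ∀ i j, Wlo i j < W' i j ∧ W' i j < Whi i j) :
    sInf { v : ℝ | ∃ P : Matrix (Fin m) (Fin n) ℝ,
        v = sSup { u : ℝ | ∃ W : Matrix (Fin n) (Fin n) ℝ, W.IsSymm ∧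
            (∀ i j, Wlo i j ≤ W i j ∧ W i j ≤ Whi i j) ∧ W.PosSemidef ∧
            u = ∑ t : Fin T,
              (y t - (S * P) *ᵥ yhat t) ⬝ᵥ (W *ᵥ (y t - (S * P) *ᵥ yhat t)) } } =
    sInf { v : ℝ | ∃ (Xhi Xlo : Matrix (Fin n) (Fin n) ℝ)
        (P : Matrix (Fin m) (Fin n) ℝ),
        Xhi.IsSymm ∧ Xlo.IsSymm ∧
        (∀ i j, 0 ≤ Xhi i j) ∧ (∀ i j, 0 ≤ Xlo i j) ∧
        (Matrix.fromBlocks (Xhi - Xlo)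
          (Matrix.of fun (i : Fin n) (t : Fin T) => (y t - (S * P) *ᵥ yhat t) i)
          (Matrix.of fun (i : Fin n) (t : Fin T) => (y t - (S * P) *ᵥ yhat t) i)ᵀ
          (1 : Matrix (Fin T) (Fin T) ℝ)).PosSemidef ∧
        v = (Whiᵀ * Xhi).trace - (Wloᵀ * Xlo).trace } := by
  obtain ⟨W', -, hW', hlt⟩ := hstrict
  have hbox : ∀ i j, Wlo i j ≤ W' i j ∧ W' i j ≤ Whi i j := fun i j =>
    ⟨(hlt i j).1.le, (hlt i j).2.le⟩
  let E : Matrix (Fin m) (Fin n) ℝ → Matrix (Fin n) (Fin T) ℝ := fun P =>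
    of fun i t => (y t - (S * P) *ᵥ yhat t) i
  have hbdd : ∀ P, (0 : ℝ) ∈ lowerBounds (boxDualValues Wlo Whi (E P * (E P)ᵀ)) := fun P v hv => by
    refine le_trans ?_ (primal_le_dual
      ⟨W', isHermitian_iff_isSymm.1 hW'.isHermitian, hbox, hW'.posSemidef, rfl⟩ hv)
    exact trace_mul_nonneg_of_posSemidef hW'.posSemidef
      (posSemidef_self_mul_conjTranspose (E P)).dotProduct_mulVec_nonneg
  have hne := fun P => boxDualValues_nonempty Wlo Whi (E P * (E P)ᵀ)
  have hprimal : ∀ P, sSup { u : ℝ | ∃ W : Matrix (Fin n) (Fin n) ℝ, W.IsSymm ∧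
      (∀ i j, Wlo i j ≤ W i j ∧ W i j ≤ Whi i j) ∧ W.PosSemidef ∧
      u = ∑ t : Fin T, (y t - (S * P) *ᵥ yhat t) ⬝ᵥ (W *ᵥ (y t - (S * P) *ᵥ yhat t)) } =
      sInf (boxDualValues Wlo Whi (E P * (E P)ᵀ)) := fun P => by
    rw [← sSup_boxPrimalValues_eq_sInf_boxDualValues hW'.posSemidef hbox hWlo hWhi]
    simp only [boxPrimalValues, ← sum_dotProduct_mulVec_eq_trace]
    rfl
  have hdual : { v : ℝ | ∃ (Xhi Xlo : Matrix (Fin n) (Fin n) ℝ) (P : Matrix (Fin m) (Fin n) ℝ),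
        Xhi.IsSymm ∧ Xlo.IsSymm ∧ (∀ i j, 0 ≤ Xhi i j) ∧ (∀ i j, 0 ≤ Xlo i j) ∧
        (fromBlocks (Xhi - Xlo) (E P) (E P)ᵀ (1 : Matrix (Fin T) (Fin T) ℝ)).PosSemidef ∧
        v = (Whiᵀ * Xhi).trace - (Wloᵀ * Xlo).trace } =
      ⋃ P, boxDualValues Wlo Whi (E P * (E P)ᵀ) := by
    ext v
    rw [Set.mem_iUnion]
    constructor
    · rintro ⟨Xhi, Xlo, P, hs, hs', hhi, hlo, hq, hv⟩
      exact ⟨P, Xhi, Xlo, hs, hs', hhi, hlo,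
        (posSemidef_fromBlocks_one_iff (hs.sub hs') _).1 hq, hv⟩
    · rintro ⟨P, Xhi, Xlo, hs, hs', hhi, hlo, hq, hv⟩
      exact ⟨Xhi, Xlo, P, hs, hs', hhi, hlo,
        (posSemidef_fromBlocks_one_iff (hs.sub hs') _).2 hq, hv⟩
  simp only [hprimal]
  exact (sInf_setOf_eq_sInf_iUnion _ hne hbdd).trans (congrArg sInf hdual.symm)
end

section
/- Let n, T be positive natural numbers and let e₁, …, e_T ∈ ℝⁿ. Let E ∈ ℝ^{n×T} be the matrix whose t-th column is e_t. Let W̲ and W̄ be symmetric real n×n matrices, and assume there exists a symmetric positive definite real n×n matrix W′ with W̲ᵢⱼ < W′ᵢⱼ < W̄ᵢⱼ for all indices i, j. Then strong duality holds between the inner maximization and its dual: the supremum of ∑_{t=1}^{T} e_tᵀ W e_t over all symmetric W ∈ ℝ^{n×n} with W̲ ≤ W ≤ W̄ entrywise and W positive semidefinite equals the infimum of tr(W̄ᵀ X̄) − tr(W̲ᵀ X̲) over all symmetric X̄, X̲ ∈ ℝ^{n×n} with all entries nonnegative such that X̄ − X̲ − E·Eᵀ is positive semidefinite. -/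
open Matrix

namespace Matrix

variable {m n : Type*} [Fintype m] [Fintype n]

lemma trace_transpose_mul_eq_sum {R : Type*} [NonUnitalNonAssocSemiring R] (A B : Matrix m n R) :
    (Aᵀ * B).trace = ∑ i, ∑ j, A i j * B i j := by
  simp only [trace, diag_apply, mul_apply, transpose_apply]
  exact Finset.sum_comm

open scoped MatrixOrder in
lemma PosSemidef.trace_transpose_mul_nonneg {A B : Matrix n n ℝ}
    (hA : A.PosSemidef) (hB : B.PosSemidef) : 0 ≤ (Aᵀ * B).trace := by
  classical
  obtain ⟨C, hC⟩ := CStarAlgebra.nonneg_iff_eq_star_mul_self.mp hA.transpose.nonneg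
  rw [hC, star_eq_conjTranspose, Matrix.mul_assoc, trace_mul_comm]
  exact (hB.mul_mul_conjTranspose_same C).trace_nonneg

lemma sum_dotProduct_mulVec_eq_trace {R : Type*} [CommSemiring R] (A : Matrix n n R)
    (B : Matrix n m R) :
    ∑ t, (fun i => B i t) ⬝ᵥ (A *ᵥ fun i => B i t) = (Aᵀ * (B * Bᵀ)).trace := by
  rw [trace_transpose_mul_eq_sum]
  simp only [dotProduct, mulVec, mul_apply, transpose_apply, Finset.mul_sum]
  rw [Finset.sum_comm]
  refine Finset.sum_congr rfl fun i _ => ?_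
  rw [Finset.sum_comm]
  refine Finset.sum_congr rfl fun j _ => Finset.sum_congr rfl fun t _ => ?_
  ring

/-- Every linear functional on matrices is a trace pairing with a fixed matrix. -/
lemma exists_linearMap_eq_trace (L : Matrix m n ℝ →ₗ[ℝ] ℝ) :
    ∃ Z : Matrix m n ℝ, ∀ W, L W = (Wᵀ * Z).trace := by
  classical
  refine ⟨of fun i j => L (single i j 1), fun W => ?_⟩
  rw [trace_transpose_mul_eq_sum]
  conv_lhs => rw [matrix_eq_sum_single W]
  simp only [map_sum, of_apply]
  refine Finset.sum_congr rfl fun i _ => Finset.sum_congr rfl fun j _ => ?_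
  rw [← smul_eq_mul, ← map_smul, smul_single, smul_eq_mul, mul_one]

lemma isOpen_setOf_strict_box (A B : Matrix m n ℝ) :
    IsOpen {W : Matrix m n ℝ | ∀ i j, A i j < W i j ∧ W i j < B i j} := by
  simp only [Set.ofPred_forall]
  refine isOpen_iInter_of_finite fun i => isOpen_iInter_of_finite fun j => ?_
  have h : Continuous fun W : Matrix m n ℝ => W i j := continuous_id.matrix_elem i j
  exact (isOpen_lt continuous_const h).inter (isOpen_lt h continuous_const)

/-- Weak duality between box-constrained semidefinite maximization and its dual. -/
lemma trace_le_of_box_of_posSemidef {A B C W X Y : Matrix n n ℝ}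
    (hbox : ∀ i j, A i j ≤ W i j ∧ W i j ≤ B i j) (hW : W.PosSemidef)
    (hX : ∀ i j, 0 ≤ X i j) (hY : ∀ i j, 0 ≤ Y i j) (hXY : (X - Y - C).PosSemidef) :
    (Wᵀ * C).trace ≤ (Bᵀ * X).trace - (Aᵀ * Y).trace := by
  have h := hW.trace_transpose_mul_nonneg hXY
  rw [Matrix.mul_sub, Matrix.mul_sub, trace_sub, trace_sub] at h
  have h₁ : (Wᵀ * X).trace ≤ (Bᵀ * X).trace := by
    simp only [trace_transpose_mul_eq_sum]
    exact Finset.sum_le_sum fun i _ => Finset.sum_le_sum fun j _ =>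
      mul_le_mul_of_nonneg_right (hbox i j).2 (hX i j)
  have h₂ : (Aᵀ * Y).trace ≤ (Wᵀ * Y).trace := by
    simp only [trace_transpose_mul_eq_sum]
    exact Finset.sum_le_sum fun i _ => Finset.sum_le_sum fun j _ =>
      mul_le_mul_of_nonneg_right (hbox i j).1 (hY i j)
  linarith

/-- The maximum of a linear functional over a box is attained at a vertex, where its value is
given by the positive and negative parts of the coefficients. -/
lemma trace_vertex_eq (A B D : Matrix n n ℝ) :
    ((of fun i j => if 0 ≤ D i j then B i j else A i j)ᵀ * D).trace =
      (Bᵀ * D.map fun x => x⁺).trace - (Aᵀ * D.map fun x => x⁻).trace := by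
  simp only [trace_transpose_mul_eq_sum, ← Finset.sum_sub_distrib]
  refine Finset.sum_congr rfl fun i _ => Finset.sum_congr rfl fun j _ => ?_
  simp only [of_apply, map_apply]
  split_ifs with h
  · simp [posPart_eq_self.mpr h, negPart_eq_zero.mpr h]
  · have h' := (not_le.mp h).le
    simp [posPart_eq_zero.mpr h', negPart_eq_neg.mpr h']

lemma le_of_forall_segment_le {a b u : ℝ}
    (h : ∀ s : ℝ, 0 ≤ s → s < 1 → a + s * (b - a) ≤ u) : b ≤ u := by
  have ha : a ≤ u := by simpa using h 0 le_rfl one_pos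
  by_contra! hb
  have hd : 0 < b - a := by linarith
  have hq : (b - u) / (2 * (b - a)) * (b - a) = (b - u) / 2 := by field_simp
  have hq₁ : (b - u) / (2 * (b - a)) ≤ 1 := by
    rw [div_le_one (by linarith)]; linarith
  have hq₀ : 0 < (b - u) / (2 * (b - a)) := div_pos (by linarith) (by linarith)
  have := h (1 - (b - u) / (2 * (b - a))) (by linarith) (by linarith)
  rw [sub_mul, hq] at this
  linarith

/-- A Lagrange multiplier for the semidefinite constraint, under Slater's condition. -/
lemma exists_multiplier {A B C : Matrix n n ℝ} {p : ℝ}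
    (hA : A.IsSymm) (hB : B.IsSymm) (hC : C.IsSymm)
    (hslater : ∃ W : Matrix n n ℝ, W.PosSemidef ∧ ∀ i j, A i j < W i j ∧ W i j < B i j)
    (hp : ∀ W : Matrix n n ℝ, W.PosSemidef → (∀ i j, A i j < W i j ∧ W i j < B i j) →
      (Wᵀ * C).trace ≤ p) :
    ∃ D : Matrix n n ℝ, D.IsSymm ∧ (D - C).PosSemidef ∧
      (Bᵀ * D.map fun x => x⁺).trace - (Aᵀ * D.map fun x => x⁻).trace ≤ p := by
  obtain ⟨W', hW', hbox'⟩ := hslater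
  let φ : Matrix n n ℝ →ₗ[ℝ] ℝ :=
    { toFun := fun W => (Wᵀ * C).trace
      map_add' := fun X Y => by rw [transpose_add, Matrix.add_mul, trace_add]
      map_smul' := fun c X => by
        rw [transpose_smul, Matrix.smul_mul, trace_smul, RingHom.id_apply] }
  have hφc : Continuous φ := φ.continuous_of_finiteDimensional
  have hφp : ∀ W : Matrix n n ℝ, W.PosSemidef → (∀ i j, A i j < W i j ∧ W i j < B i j) →
      φ W ≤ p := hp
  let S : Set (Matrix n n ℝ × ℝ) :=
    {q | (∀ i j, A i j < q.1 i j ∧ q.1 i j < B i j) ∧ q.2 < φ q.1}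
  let P : Set (Matrix n n ℝ × ℝ) := {q | q.1.PosSemidef ∧ p ≤ q.2}
  have hSo : IsOpen S := ((isOpen_setOf_strict_box A B).preimage continuous_fst).inter
    (isOpen_lt continuous_snd (hφc.comp continuous_fst))
  have hSc : Convex ℝ S := by
    rintro ⟨X, r⟩ ⟨hX, hr⟩ ⟨Y, s⟩ ⟨hY, hs⟩ a b ha hb hab
    refine ⟨fun i j => ⟨?_, ?_⟩, ?_⟩
    · exact (convex_Ioi (A i j)) (hX i j).1 (hY i j).1 ha hb hab
    · exact (convex_Iio (B i j)) (hX i j).2 (hY i j).2 ha hb hab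
    · have : a • (φ X - r) + b • (φ Y - s) ∈ Set.Ioi (0 : ℝ) :=
        (convex_Ioi (0 : ℝ)) (sub_pos.mpr hr) (sub_pos.mpr hs) ha hb hab
      simp only [Set.mem_Ioi, smul_eq_mul] at this
      simp only [Prod.smul_mk, Prod.mk_add_mk, map_add, map_smul, smul_eq_mul]
      linarith
  have hPc : Convex ℝ P := by
    rintro ⟨X, r⟩ ⟨hX, hr⟩ ⟨Y, s⟩ ⟨hY, hs⟩ a b ha hb hab
    exact ⟨(hX.smul ha).add (hY.smul hb), (convex_Ici p) hr hs ha hb hab⟩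
  have hdisj : Disjoint S P := Set.disjoint_left.mpr fun q hS hP =>
    absurd (hφp q.1 hP.1 hS.1) (not_le.mpr (hP.2.trans_lt hS.2))
  obtain ⟨f, u, hfS, hfP⟩ := geometric_hahn_banach_open hSc hSo hPc hdisj
  obtain ⟨Z, hZ⟩ := exists_linearMap_eq_trace
    ((f : Matrix n n ℝ × ℝ →ₗ[ℝ] ℝ) ∘ₗ LinearMap.inl ℝ (Matrix n n ℝ) ℝ)
  set β : ℝ := f (0, 1)
  have hf : ∀ W r, f (W, r) = (Wᵀ * Z).trace + r * β := fun W r => by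
    have h₁ : ((W, r) : Matrix n n ℝ × ℝ) = (W, 0) + r • (0, 1) := by simp
    rw [h₁, map_add, map_smul, smul_eq_mul, ← hZ]
    rfl
  have hS : ∀ W : Matrix n n ℝ, (∀ i j, A i j < W i j ∧ W i j < B i j) → ∀ r < φ W,
      (Wᵀ * Z).trace + r * β < u := fun W hW r hr => hf W r ▸ hfS (W, r) ⟨hW, hr⟩
  have hP : ∀ W : Matrix n n ℝ, W.PosSemidef → ∀ r, p ≤ r → u ≤ (Wᵀ * Z).trace + r * β :=
    fun W hW r hr => hf W r ▸ hfP (W, r) ⟨hW, hr⟩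
  have hβ : 0 < β := by
    have h₁ := hS W' hbox' (φ W' - 1) (by linarith)
    have h₂ := hP W' hW' p le_rfl
    have h₃ := hφp W' hW' hbox'
    have h₄ : 0 < (p - (φ W' - 1)) * β := by linarith
    exact pos_of_mul_pos_right h₄ (by linarith)
  have hu : u ≤ p * β := by simpa using hP 0 .zero p le_rfl
  have hcone : ∀ W : Matrix n n ℝ, W.PosSemidef → 0 ≤ (Wᵀ * Z).trace := fun W hW => by
    by_contra! hneg
    obtain ⟨k, hk⟩ := exists_nat_gt ((p * β - u) / -(Wᵀ * Z).trace)
    rw [div_lt_iff₀ (by linarith)] at hk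
    have := hP ((k : ℝ) • W) (hW.smul k.cast_nonneg) p le_rfl
    rw [transpose_smul, Matrix.smul_mul, trace_smul, smul_eq_mul] at this
    linarith
  have hopen : ∀ W : Matrix n n ℝ, (∀ i j, A i j < W i j ∧ W i j < B i j) →
      (Wᵀ * Z).trace + φ W * β ≤ u := fun W hW => by
    by_contra! h
    set δ := (Wᵀ * Z).trace + φ W * β - u
    have h₁ := hS W hW (φ W - δ / β) (by have := div_pos (sub_pos.mpr h) hβ; linarith)
    rw [sub_mul, div_mul_cancel₀ _ hβ.ne'] at h₁
    simp only [δ] at h₁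
    linarith
  have hclosed : ∀ W : Matrix n n ℝ, (∀ i j, A i j ≤ W i j ∧ W i j ≤ B i j) →
      (Wᵀ * Z).trace + φ W * β ≤ u := fun W hW => by
    refine le_of_forall_segment_le (a := (W'ᵀ * Z).trace + φ W' * β) fun s hs₀ hs₁ => ?_
    have := hopen ((1 - s) • W' + s • W) fun i j => by
      obtain ⟨h₁, h₂⟩ := hbox' i j
      obtain ⟨h₃, h₄⟩ := hW i j
      simp only [add_apply, smul_apply, smul_eq_mul]
      constructor <;> nlinarith
    simp only [transpose_add, transpose_smul, Matrix.add_mul, Matrix.smul_mul, trace_add,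
      trace_smul, smul_eq_mul, map_add, map_smul] at this
    linarith
  -- Symmetrize the multiplier and normalize the objective coefficient.
  let M : Matrix n n ℝ := (2 * β)⁻¹ • (Z + Zᵀ)
  have hMs : M.IsSymm := by
    simp only [M, IsSymm, transpose_smul, transpose_add, transpose_transpose, add_comm]
  have hMtr : ∀ W : Matrix n n ℝ, W.IsSymm → (Wᵀ * M).trace = (Wᵀ * Z).trace / β :=
    fun W hW => by
      have h : (Wᵀ * Zᵀ).trace = (Wᵀ * Z).trace := by
        rw [← transpose_mul, trace_transpose, trace_mul_comm, hW.eq]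
      simp only [M, Matrix.mul_smul, Matrix.mul_add, trace_smul, trace_add, smul_eq_mul, h]
      field_simp
      ring
  have hM : M.PosSemidef := by
    refine .of_dotProduct_mulVec_nonneg (by simpa using hMs) fun x => ?_
    have hx := posSemidef_vecMulVec_self_star x
    have h := div_nonneg (hcone _ hx) hβ.le
    rw [← hMtr _ (by simpa using hx.1), trace_transpose_mul_eq_sum] at h
    convert h using 1
    simp only [dotProduct, mulVec, vecMulVec_apply, star_trivial, Finset.mul_sum]
    refine Finset.sum_congr rfl fun i _ => Finset.sum_congr rfl fun j _ => ?_
    ring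
  have hD : (M + C).IsSymm := hMs.add hC
  refine ⟨M + C, hD, by simpa using hM, ?_⟩
  rw [← trace_vertex_eq]
  set V : Matrix n n ℝ := of fun i j => if 0 ≤ (M + C) i j then B i j else A i j
  have hVs : V.IsSymm := by
    ext i j
    simp only [V, transpose_apply, of_apply, hD.apply i j, hA.apply i j, hB.apply i j]
  have hVbox := hclosed V fun i j => by
    have := ((hbox' i j).1.trans (hbox' i j).2).le
    simp only [V, of_apply]
    split_ifs <;> simp [this]
  rw [Matrix.mul_add, trace_add, hMtr V hVs]
  change _ + φ V ≤ p
  have h := (div_le_div_iff_of_pos_right hβ).mpr (hVbox.trans hu)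
  rwa [add_div, mul_div_cancel_right₀ _ hβ.ne', mul_div_cancel_right₀ _ hβ.ne'] at h

end Matrix

/-- Strong duality between the inner maximization over the box uncertainty set
and its semidefinite dual. -/
theorem inner_strong_duality
    (n T : ℕ) (hn : 0 < n) (hT : 0 < T)
    (e : Fin T → Fin n → ℝ)
    (E : Matrix (Fin n) (Fin T) ℝ)
    (hE : ∀ i t, E i t = e t i)
    (Wlo Whi : Matrix (Fin n) (Fin n) ℝ)
    (hWlo : Wlo.IsSymm) (hWhi : Whi.IsSymm)
    (hstrict : ∃ W' : Matrix (Fin n) (Fin n) ℝ, W'.IsSymm ∧ W'.PosDef ∧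
      ∀ i j, Wlo i j < W' i j ∧ W' i j < Whi i j) :
    sSup { u : ℝ | ∃ W : Matrix (Fin n) (Fin n) ℝ, W.IsSymm ∧
        (∀ i j, Wlo i j ≤ W i j ∧ W i j ≤ Whi i j) ∧ W.PosSemidef ∧
        u = ∑ t : Fin T, (e t) ⬝ᵥ (W *ᵥ (e t)) } =
    sInf { v : ℝ | ∃ Xhi Xlo : Matrix (Fin n) (Fin n) ℝ,
        Xhi.IsSymm ∧ Xlo.IsSymm ∧
        (∀ i j, 0 ≤ Xhi i j) ∧ (∀ i j, 0 ≤ Xlo i j) ∧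
        (Xhi - Xlo - E * Eᵀ).PosSemidef ∧
        v = (Whiᵀ * Xhi).trace - (Wloᵀ * Xlo).trace } := by
  obtain ⟨W', hW's, hW', hbox'⟩ := hstrict
  have hobj : ∀ W : Matrix (Fin n) (Fin n) ℝ,
      ∑ t : Fin T, (e t) ⬝ᵥ (W *ᵥ (e t)) = (Wᵀ * (E * Eᵀ)).trace := fun W => by
    rw [← sum_dotProduct_mulVec_eq_trace]
    simp only [hE]
  have hC : (E * Eᵀ).IsSymm := transpose_mul _ _
  simp only [hobj]
  set primal := {u : ℝ | _}
  set dual := {v : ℝ | _}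
  have hparts : ∀ D : Matrix (Fin n) (Fin n) ℝ, D.IsSymm → (D - E * Eᵀ).PosSemidef →
      (Whiᵀ * D.map fun x => x⁺).trace - (Wloᵀ * D.map fun x => x⁻).trace ∈ dual :=
    fun D hD hDC => by
      refine ⟨_, _, hD.map _, hD.map _, fun i j => posPart_nonneg _, fun i j => negPart_nonneg _,
        ?_, rfl⟩
      convert hDC using 2
      ext i j
      exact posPart_sub_negPart (D i j)
  have hweak : ∀ u ∈ primal, ∀ v ∈ dual, u ≤ v := by
    rintro _ ⟨W, -, hbox, hW, rfl⟩ _ ⟨X, Y, -, -, hX, hY, hXY, rfl⟩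
    exact trace_le_of_box_of_posSemidef hbox hW hX hY hXY
  have hprimal : primal.Nonempty :=
    ⟨_, W', hW's, fun i j => ⟨(hbox' i j).1.le, (hbox' i j).2.le⟩, hW'.posSemidef, rfl⟩
  have hdual : dual.Nonempty := ⟨_, hparts (E * Eᵀ) hC (by simpa using PosSemidef.zero)⟩
  have hbdd : BddAbove primal := hdual.imp fun v hv u hu => hweak u hu v hv
  obtain ⟨D, hDs, hDC, hD⟩ := exists_multiplier (p := sSup primal) hWlo hWhi hC
    ⟨W', hW'.posSemidef, hbox'⟩ fun W hW hbox => le_csSup hbdd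
      ⟨W, by simpa using hW.1, fun i j => ⟨(hbox i j).1.le, (hbox i j).2.le⟩, hW, rfl⟩
  refine le_antisymm
    (csSup_le hprimal fun u hu => le_csInf hdual fun v hv => hweak u hu v hv)
    ((csInf_le ?_ (hparts D hDs hDC)).trans hD)
  exact hprimal.imp fun u hu v hv => hweak u hu v hv
end

section
/- Let n, T be positive natural numbers and let e₁, …, e_T ∈ ℝⁿ. Let W̲, W̄, W, X̄, X̲ be symmetric real n×n matrices. Assume: (i) W̲ ≤ W ≤ W̄ entrywise and W is positive semidefinite; (ii) all entries of X̄ and of X̲ are nonnegative; (iii) X̄ − X̲ − ∑_{t=1}^{T} e_t e_tᵀ is positive semidefinite. Then ∑_{t=1}^{T} e_tᵀ W e_t ≤ tr(W̄ᵀ X̄) − tr(W̲ᵀ X̲) (weak duality between the inner maximization problem and its semidefinite dual). -/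
open Matrix

/-- The trace of the product of two real positive semidefinite matrices is nonnegative. -/
theorem Matrix.PosSemidef.trace_mul_nonneg {ι : Type*} [Fintype ι] {A B : Matrix ι ι ℝ}
    (hA : A.PosSemidef) (hB : B.PosSemidef) : 0 ≤ (A * B).trace := by
  obtain ⟨m, v, rfl⟩ := posSemidef_iff_eq_sum_vecMulVec.mp hB
  simp only [Matrix.mul_sum, trace_sum, mul_vecMulVec, trace_vecMulVec]
  refine Finset.sum_nonneg fun i _ => ?_
  rw [dotProduct_comm]
  exact hA.dotProduct_mulVec_nonneg (v i)

/-- The trace pairing with an entrywise nonnegative matrix is monotone for the entrywise order. -/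
theorem Matrix.trace_transpose_mul_le_trace_transpose_mul {ι κ : Type*} [Fintype ι] [Fintype κ]
    {A B X : Matrix ι κ ℝ} (h : ∀ i j, A i j ≤ B i j) (hX : ∀ i j, 0 ≤ X i j) :
    (Aᵀ * X).trace ≤ (Bᵀ * X).trace := by
  simp only [trace, diag_apply, mul_apply, transpose_apply]
  gcongr with j _ i _
  · exact hX i j
  · exact h i j

/-- Weak duality between the inner maximization problem and its semidefinite dual. -/
theorem inner_weak_duality
    (n T : ℕ) (hn : 0 < n) (hT : 0 < T)
    (e : Fin T → Fin n → ℝ)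
    (Wlo Whi W Xhi Xlo : Matrix (Fin n) (Fin n) ℝ)
    (hWlo : Wlo.IsSymm) (hWhi : Whi.IsSymm) (hW : W.IsSymm)
    (hXhi : Xhi.IsSymm) (hXlo : Xlo.IsSymm)
    (hbox : ∀ i j, Wlo i j ≤ W i j ∧ W i j ≤ Whi i j)
    (hWpsd : W.PosSemidef)
    (hXhiNonneg : ∀ i j, 0 ≤ Xhi i j) (hXloNonneg : ∀ i j, 0 ≤ Xlo i j)
    (hpsd : (Xhi - Xlo - ∑ t : Fin T, vecMulVec (e t) (e t)).PosSemidef) :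
    ∑ t : Fin T, (e t) ⬝ᵥ (W *ᵥ (e t)) ≤ (Whiᵀ * Xhi).trace - (Wloᵀ * Xlo).trace := by
  have hdual := hWpsd.trace_mul_nonneg hpsd
  have hhi := trace_transpose_mul_le_trace_transpose_mul (fun i j => (hbox i j).2) hXhiNonneg
  have hlo := trace_transpose_mul_le_trace_transpose_mul (fun i j => (hbox i j).1) hXloNonneg
  rw [hW.eq] at hhi hlo
  simp only [Matrix.mul_sub, Matrix.mul_sum, trace_sub, trace_sum, mul_vecMulVec,
    trace_vecMulVec, dotProduct_comm (W *ᵥ _)] at hdual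
  linarith
end

section
/- Let n, T be positive natural numbers, let E be a real n×T matrix, let J ∈ ℝ^{n×n} be the matrix whose entries are all one, and let I_n be the n×n identity matrix. Then there exists α₀ > 0 such that for every α ≥ α₀, the matrices X̄′ = E·Eᵀ + α·J + I_n and X̲′ = α·J satisfy: every entry of X̄′ is strictly positive, every entry of X̲′ is strictly positive, and the (n+T)×(n+T) block matrix [[X̄′ − X̲′, E], [Eᵀ, I_T]] is positive definite. In particular, the semidefinite dual problem admits a strictly feasible solution for every E. -/
open Matrix

/-- The Gram-type block matrix `[[E Eᵀ + 1, E], [Eᵀ, 1]]` is positive definite, since it factors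
as `L Lᵀ` with `L` unipotent. -/
theorem posDef_fromBlocks_mul_transpose_add_one {m k : Type*} [Fintype m] [DecidableEq m]
    [Fintype k] [DecidableEq k] (E : Matrix m k ℝ) :
    (Matrix.fromBlocks (E * Eᵀ + 1) E Eᵀ (1 : Matrix k k ℝ)).PosDef := by
  have hL : IsUnit (Matrix.fromBlocks (1 : Matrix m m ℝ) E 0 (1 : Matrix k k ℝ)) :=
    isUnit_fromBlocks_zero₂₁.2 ⟨isUnit_one, isUnit_one⟩
  convert PosDef.mul_conjTranspose_self _ (vecMul_injective_of_isUnit hL) using 1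
  simp [conjTranspose_eq_transpose_of_trivial, fromBlocks_transpose, fromBlocks_multiply,
    add_comm]

/-- The semidefinite dual problem admits a strictly feasible solution. -/
theorem dual_strictly_feasible
    (n T : ℕ) (hn : 0 < n) (hT : 0 < T)
    (E : Matrix (Fin n) (Fin T) ℝ)
    (J : Matrix (Fin n) (Fin n) ℝ) (hJ : ∀ i j, J i j = 1) :
    ∃ α₀ : ℝ, 0 < α₀ ∧ ∀ α : ℝ, α₀ ≤ α →
      (∀ i j, 0 < (E * Eᵀ + α • J + 1 : Matrix (Fin n) (Fin n) ℝ) i j) ∧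
      (∀ i j, 0 < (α • J : Matrix (Fin n) (Fin n) ℝ) i j) ∧
      (Matrix.fromBlocks
        ((E * Eᵀ + α • J + 1) - α • J : Matrix (Fin n) (Fin n) ℝ) E Eᵀ
        (1 : Matrix (Fin T) (Fin T) ℝ)).PosDef := by
  have hS : 0 ≤ ∑ p : Fin n × Fin n, |(E * Eᵀ) p.1 p.2| :=
    Finset.sum_nonneg fun _ _ => abs_nonneg _
  refine ⟨1 + ∑ p : Fin n × Fin n, |(E * Eᵀ) p.1 p.2|, by linarith,
    fun α hα => ⟨fun i j => ?_, fun i j => ?_, ?_⟩⟩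
  · have hle : |(E * Eᵀ) i j| ≤ ∑ p : Fin n × Fin n, |(E * Eᵀ) p.1 p.2| :=
      Finset.single_le_sum (f := fun p : Fin n × Fin n => |(E * Eᵀ) p.1 p.2|)
        (fun _ _ => abs_nonneg _) (Finset.mem_univ (i, j))
    have hone : 0 ≤ (1 : Matrix (Fin n) (Fin n) ℝ) i j := by
      rw [one_apply]
      split_ifs <;> norm_num
    have hneg := neg_abs_le ((E * Eᵀ) i j)
    rw [Matrix.add_apply, Matrix.add_apply, Matrix.smul_apply, hJ, smul_eq_mul]
    linarith
  · rw [Matrix.smul_apply, hJ, smul_eq_mul]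
    linarith
  · rw [show E * Eᵀ + α • J + 1 - α • J = E * Eᵀ + 1 by abel]
    exact posDef_fromBlocks_mul_transpose_add_one E
end
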